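/- Let R be an associative ring with unity. Then R is a right p.q.-Baer ring if and only if the polynomial ring R[x] is a right p.q.-Baer ring. -/

import Mathlib

universe u

/-- A ring `S` is right principally quasi-Baer (right p.q.-Baer) if for every `s ∈ S`
the right annihilator of the principal right ideal `sS` is generated, as a right ideal,
by an idempotent: `r_S(sS) = eS` with `e² = e`. -/
def IsRightPQBaerRing (S : Type u) [Ring S] : Prop :=
  ∀ s : S, ∃ e : S, e * e = e ∧
    {a : S | ∀ r : S, s * r * a = 0} = {b : S | ∃ r : S, b = e * r}

theorem isRightPQBaerRing_iff {S : Type u} [Ring S] :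
    IsRightPQBaerRing S ↔ ∀ s : S, ∃ e : S, (∀ r, s * r * e = 0) ∧
      ∀ a, (∀ r, s * r * a = 0) → e * a = a := by
  refine forall_congr' fun s => exists_congr fun e => ?_
  constructor
  · rintro ⟨he, h⟩
    have key : ∀ a, (∀ r, s * r * a = 0) ↔ ∃ r, a = e * r := fun a => Set.ext_iff.mp h a
    refine ⟨(key e).2 ⟨1, (mul_one e).symm⟩, fun a ha => ?_⟩
    obtain ⟨r, rfl⟩ := (key a).1 ha
    rw [← mul_assoc, he]
  · rintro ⟨h₁, h₂⟩
    refine ⟨h₂ e h₁, Set.ext fun a => ⟨fun ha => ⟨a, (h₂ a ha).symm⟩, ?_⟩⟩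
    rintro ⟨t, rfl⟩ r
    rw [← mul_assoc, h₁, zero_mul]

theorem IsRightPQBaerRing.exists_annihilator_lt {S : Type u} [Ring S]
    (hS : IsRightPQBaerRing S) (s : ℕ → S) (n : ℕ) :
    ∃ e : S, (∀ i < n, ∀ r, s i * r * e = 0) ∧
      ∀ a, (∀ i < n, ∀ r, s i * r * a = 0) → e * a = a := by
  induction n with
  | zero => exact ⟨1, by simp, by simp⟩
  | succ n ih =>
    obtain ⟨e, he, he'⟩ := ih
    obtain ⟨d, hd, hd'⟩ := isRightPQBaerRing_iff.1 hS (s n)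
    refine ⟨e * d, fun i hi r => ?_, fun a ha => ?_⟩
    · rcases Nat.lt_succ_iff_lt_or_eq.1 hi with hi | rfl
      · rw [← mul_assoc, he i hi, zero_mul]
      · rw [← mul_assoc, mul_assoc (s i), hd]
    · rw [mul_assoc, hd' a (ha n n.lt_succ_self),
        he' a fun i hi => ha i (hi.trans n.lt_succ_self)]

open Polynomial in
theorem IsRightPQBaerRing.coeff_zero_mul_mul_coeff_eq_zero {R : Type u} [Ring R]
    (hR : IsRightPQBaerRing R) {f g : R[X]} (h : ∀ c : R, f * (C c * g) = 0) (j : ℕ) (c : R) :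
    f.coeff 0 * c * g.coeff j = 0 := by
  obtain ⟨e, he, he'⟩ := isRightPQBaerRing_iff.1 hR (f.coeff 0)
  induction j using Nat.strong_induction_on generalizing c with
  | _ j ih =>
    have hj := congrArg (fun p => coeff p j) (h (c * (1 - e)))
    rw [coeff_mul, coeff_zero] at hj
    simp only [coeff_C_mul] at hj
    rw [Finset.sum_eq_single (0, j)] at hj
    · have h0 : f.coeff 0 * c * e * g.coeff j = 0 := by rw [he, zero_mul]
      simpa only [mul_sub, sub_mul, mul_one, ← mul_assoc, h0, sub_zero] using hj
    · rintro ⟨a, b⟩ hab hne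
      have hb : b < j := by
        have := Finset.HasAntidiagonal.mem_antidiagonal.1 hab
        simp only [ne_eq, Prod.mk.injEq, not_and] at hne
        dsimp only at this
        omega
      have := he' _ (ih b hb)
      dsimp only
      rw [mul_assoc c, sub_mul, this, one_mul, sub_self, mul_zero, mul_zero]
    · simp

open Polynomial in
theorem IsRightPQBaerRing.coeff_mul_mul_coeff_eq_zero {R : Type u} [Ring R]
    (hR : IsRightPQBaerRing R) {f g : R[X]} (h : ∀ c : R, f * (C c * g) = 0) (i j : ℕ) (c : R) :
    f.coeff i * c * g.coeff j = 0 := by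
  induction i generalizing f with
  | zero => exact hR.coeff_zero_mul_mul_coeff_eq_zero h j c
  | succ i ih =>
    rw [← coeff_divX]
    refine ih fun c => ?_
    have h0 : C (f.coeff 0) * (C c * g) = 0 := by
      ext j
      simpa [mul_assoc] using hR.coeff_zero_mul_mul_coeff_eq_zero h j c
    have hX := h c
    rw [← X_mul_divX_add f, add_mul, h0, add_zero, mul_assoc] at hX
    ext k
    simpa using congrArg (fun p => coeff p (k + 1)) hX

/-- **Statement 5** (Corollary 2.5, Birkenmeier et al.). `R` is right p.q.-Baer if and
only if the polynomial ring `R[x]` is right p.q.-Baer. -/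
theorem isRightPQBaerRing_iff_polynomial {R : Type u} [Ring R] :
    IsRightPQBaerRing R ↔ IsRightPQBaerRing (Polynomial R) := by
  refine ⟨fun hR => isRightPQBaerRing_iff.2 fun f => ?_,
    fun hP => isRightPQBaerRing_iff.2 fun s => ?_⟩
  · obtain ⟨e, he, he'⟩ := hR.exists_annihilator_lt f.coeff (f.natDegree + 1)
    refine ⟨Polynomial.C e, fun r => ?_, fun g hg => ?_⟩
    · ext k
      rw [Polynomial.coeff_mul_C, Polynomial.coeff_mul, Finset.sum_mul, Polynomial.coeff_zero]
      refine Finset.sum_eq_zero fun p _ => ?_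
      by_cases hp : p.1 < f.natDegree + 1
      · exact he _ hp _
      · rw [Polynomial.coeff_eq_zero_of_natDegree_lt (by omega), zero_mul, zero_mul]
    · ext j
      rw [Polynomial.coeff_C_mul]
      exact he' _ fun i _ c =>
        hR.coeff_mul_mul_coeff_eq_zero (fun c => by rw [← mul_assoc, hg]) i j c
  · obtain ⟨e, he, he'⟩ := isRightPQBaerRing_iff.1 hP (Polynomial.C s)
    refine ⟨e.coeff 0, fun r => ?_, fun a ha => ?_⟩
    · simpa [Polynomial.mul_coeff_zero] using
        congrArg (fun p => Polynomial.coeff p 0) (he (Polynomial.C r))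
    · have hC : ∀ r, Polynomial.C s * r * Polynomial.C a = 0 := fun r => by
        ext k
        simpa using ha (r.coeff k)
      simpa using congrArg (fun p => Polynomial.coeff p 0) (he' _ hC)
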